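/- Let A be the Cartan matrix of type E₇ (indices ordered α, β, γ, δ, ε, η, σ, with chain α–β–γ–δ–ε–η and σ attached to δ), let s_j(n) = n − (Σᵢ nᵢ A_{ij})·e_j be the simple reflections of ℤ⁷, and set w₁ = s_ε ∘ s_β ∘ s_γ ∘ s_α ∘ s_β and w₂ = s_ε ∘ s_β ∘ s_γ ∘ s_α ∘ s_β ∘ s_η ∘ s_δ ∘ s_β. Then the orbit of the standard basis vector e_σ = (0,0,0,0,0,0,1) under the group ⟨w₁, w₂⟩ consists of exactly the seven vectors (coordinates in the order α, β, γ, δ, ε, η, σ): (0,0,0,0,0,0,1), (0,0,0,1,0,0,1), (0,1,1,1,1,0,1), (0,0,1,2,1,1,1), (1,2,2,2,2,1,1), (1,1,2,3,2,1,1), and (1,2,3,3,2,1,1). -/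

import Mathlib

/-- The Cartan matrix of type E₇, rows and columns indexed by the simple roots
α, β, γ, δ, ε, η, σ in that order (indices 0,…,6), where α–β–γ–δ–ε–η form a chain and σ is
attached to δ in the Dynkin diagram. -/
def cartanE7 : Matrix (Fin 7) (Fin 7) ℤ :=
  !![2, -1, 0, 0, 0, 0, 0;
     -1, 2, -1, 0, 0, 0, 0;
     0, -1, 2, -1, 0, 0, 0;
     0, 0, -1, 2, -1, 0, -1;
     0, 0, 0, -1, 2, -1, 0;
     0, 0, 0, 0, -1, 2, 0;
     0, 0, 0, -1, 0, 0, 2]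

/-- The linear functional n ↦ Σᵢ nᵢ A_{ij} on ℤ⁷. -/
def coeff (j : Fin 7) : (Fin 7 → ℤ) →ₗ[ℤ] ℤ :=
  ∑ i : Fin 7, cartanE7 i j • LinearMap.proj i

/-- The simple reflection s_j : ℤ⁷ → ℤ⁷, s_j(n) = n − (Σᵢ nᵢ A_{ij})·e_j, as a linear map. -/
def reflMap (j : Fin 7) : (Fin 7 → ℤ) →ₗ[ℤ] (Fin 7 → ℤ) :=
  LinearMap.id - LinearMap.smulRight (coeff j) (Pi.single j 1)

theorem reflMap_apply (j : Fin 7) (m : Fin 7 → ℤ) :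
    reflMap j m = m - (∑ i : Fin 7, cartanE7 i j * m i) • Pi.single j 1 := by
  simp only [reflMap, coeff, LinearMap.sub_apply, LinearMap.id_apply,
    LinearMap.smulRight_apply, LinearMap.sum_apply, Finset.sum_apply, LinearMap.smul_apply,
    LinearMap.proj_apply, smul_eq_mul]

theorem reflMap_involutive (j : Fin 7) : Function.Involutive (reflMap j) := by
  intro n
  have hAjj : (∑ i : Fin 7, cartanE7 i j * (Pi.single j 1 : Fin 7 → ℤ) i) = 2 := by
    fin_cases j <;> simp [cartanE7, Fin.sum_univ_seven, Pi.single_apply] <;> decide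
  rw [reflMap_apply, reflMap_apply]
  set c : ℤ := ∑ i : Fin 7, cartanE7 i j * n i with hc
  have hsum : (∑ i : Fin 7, cartanE7 i j * (n - c • Pi.single j 1 : Fin 7 → ℤ) i) = -c := by
    simp only [Pi.sub_apply, Pi.smul_apply, smul_eq_mul, mul_sub, Finset.sum_sub_distrib]
    rw [show (∑ i : Fin 7, cartanE7 i j * (c * (Pi.single j 1 : Fin 7 → ℤ) i)) =
        c * ∑ i : Fin 7, cartanE7 i j * (Pi.single j 1 : Fin 7 → ℤ) i by
      rw [Finset.mul_sum]; exact Finset.sum_congr rfl fun i _ => by ring]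
    rw [hAjj, ← hc]
    ring
  rw [hsum]
  clear_value c
  module

/-- The simple reflection s_j as a linear automorphism of ℤ⁷. -/
def simpleReflection (j : Fin 7) : (Fin 7 → ℤ) ≃ₗ[ℤ] (Fin 7 → ℤ) :=
  LinearEquiv.ofInvolutive (reflMap j) (reflMap_involutive j)

/-- w₁ = s_ε ∘ s_β ∘ s_γ ∘ s_α ∘ s_β (indices α=0, β=1, γ=2, δ=3, ε=4, η=5, σ=6);
multiplication in the automorphism group is composition, so s_β is applied first. -/
def w1 : (Fin 7 → ℤ) ≃ₗ[ℤ] (Fin 7 → ℤ) :=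
  simpleReflection 4 * simpleReflection 1 * simpleReflection 2 * simpleReflection 0 *
    simpleReflection 1

/-- w₂ = s_ε ∘ s_β ∘ s_γ ∘ s_α ∘ s_β ∘ s_η ∘ s_δ ∘ s_β. -/
def w2 : (Fin 7 → ℤ) ≃ₗ[ℤ] (Fin 7 → ℤ) :=
  simpleReflection 4 * simpleReflection 1 * simpleReflection 2 * simpleReflection 0 *
    simpleReflection 1 * simpleReflection 5 * simpleReflection 3 * simpleReflection 1

theorem simpleReflection_apply' (j : Fin 7) (m : Fin 7 → ℤ) :
    simpleReflection j m = m - (∑ i : Fin 7, cartanE7 i j * m i) • Pi.single j 1 :=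
  reflMap_apply j m

theorem refl_vec0 (a b c d e f g : ℤ) :
    simpleReflection 0 ![a, b, c, d, e, f, g] = ![b - a, b, c, d, e, f, g] := by
  rw [simpleReflection_apply']
  ext i
  fin_cases i <;> simp [cartanE7, Fin.sum_univ_seven] <;> ring

theorem refl_vec1 (a b c d e f g : ℤ) :
    simpleReflection 1 ![a, b, c, d, e, f, g] = ![a, a + c - b, c, d, e, f, g] := by
  rw [simpleReflection_apply']
  ext i
  fin_cases i <;> simp [cartanE7, Fin.sum_univ_seven] <;> ring

theorem refl_vec2 (a b c d e f g : ℤ) :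
    simpleReflection 2 ![a, b, c, d, e, f, g] = ![a, b, b + d - c, d, e, f, g] := by
  rw [simpleReflection_apply']
  ext i
  fin_cases i <;> simp [cartanE7, Fin.sum_univ_seven] <;> ring

theorem refl_vec3 (a b c d e f g : ℤ) :
    simpleReflection 3 ![a, b, c, d, e, f, g] = ![a, b, c, c + e + g - d, e, f, g] := by
  rw [simpleReflection_apply']
  ext i
  fin_cases i <;> simp [cartanE7, Fin.sum_univ_seven] <;> ring

theorem refl_vec4 (a b c d e f g : ℤ) :
    simpleReflection 4 ![a, b, c, d, e, f, g] = ![a, b, c, d, d + f - e, f, g] := by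
  rw [simpleReflection_apply']
  ext i
  fin_cases i <;> simp [cartanE7, Fin.sum_univ_seven] <;> ring

theorem refl_vec5 (a b c d e f g : ℤ) :
    simpleReflection 5 ![a, b, c, d, e, f, g] = ![a, b, c, d, e, e - f, g] := by
  rw [simpleReflection_apply']
  ext i
  fin_cases i <;> simp [cartanE7, Fin.sum_univ_seven] <;> ring

theorem w1_vec (a b c d e f g : ℤ) :
    w1 ![a, b, c, d, e, f, g] = ![c - b, d - b, a + d - b, d, d + f - e, f, g] := by
  simp only [w1, LinearEquiv.mul_apply, refl_vec0, refl_vec1, refl_vec2, refl_vec4]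
  ext i
  fin_cases i <;> simp <;> ring

theorem w2_vec (a b c d e f g : ℤ) :
    w2 ![a, b, c, d, e, f, g] = w1 (simpleReflection 5 (simpleReflection 3
      (simpleReflection 1 ![a, b, c, d, e, f, g]))) := by
  simp only [w1, w2, LinearEquiv.mul_apply]

/-- The seven vectors of the orbit. -/
def orbitSet : Set (Fin 7 → ℤ) :=
  {![0, 0, 0, 0, 0, 0, 1], ![0, 0, 0, 1, 0, 0, 1], ![0, 1, 1, 1, 1, 0, 1],
   ![0, 0, 1, 2, 1, 1, 1], ![1, 2, 2, 2, 2, 1, 1], ![1, 1, 2, 3, 2, 1, 1],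
   ![1, 2, 3, 3, 2, 1, 1]}

theorem orbitSet_finite : orbitSet.Finite := by
  unfold orbitSet
  exact Set.toFinite _

theorem w1_maps : ∀ v ∈ orbitSet, w1 v ∈ orbitSet := by
  intro v hv
  simp only [orbitSet, Set.mem_insert_iff, Set.mem_singleton_iff] at hv ⊢
  rcases hv with rfl | rfl | rfl | rfl | rfl | rfl | rfl <;> rw [w1_vec] <;> norm_num

theorem w2_maps : ∀ v ∈ orbitSet, w2 v ∈ orbitSet := by
  intro v hv
  simp only [orbitSet, Set.mem_insert_iff, Set.mem_singleton_iff] at hv ⊢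
  rcases hv with rfl | rfl | rfl | rfl | rfl | rfl | rfl <;>
    rw [w2_vec, refl_vec1, refl_vec3, refl_vec5, w1_vec] <;> norm_num

/-- An injective map of a finite set into itself also pulls the set back to itself. -/
theorem symm_maps (w : (Fin 7 → ℤ) ≃ₗ[ℤ] (Fin 7 → ℤ)) (h : ∀ v ∈ orbitSet, w v ∈ orbitSet) :
    ∀ v ∈ orbitSet, w⁻¹ v ∈ orbitSet := by
  intro v hv
  have himg : w '' orbitSet = orbitSet :=
    Set.eq_of_subset_of_ncard_le (Set.image_subset_iff.2 h)
      (Set.ncard_image_of_injective _ w.injective).ge orbitSet_finite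
  rw [← himg] at hv
  obtain ⟨u, hu, rfl⟩ := hv
  have : w⁻¹ (w u) = u := w.symm_apply_apply u
  rwa [this]

theorem closure_maps (g : (Fin 7 → ℤ) ≃ₗ[ℤ] (Fin 7 → ℤ))
    (hg : g ∈ Subgroup.closure {w1, w2}) : ∀ v ∈ orbitSet, g v ∈ orbitSet := by
  induction hg using Subgroup.closure_induction with
  | mem x hx =>
    rcases hx with rfl | rfl
    · exact w1_maps
    · exact w2_maps
  | one => exact fun v hv => hv
  | mul x y _ _ hx hy => exact fun v hv => hx _ (hy v hv)
  | inv x _ hx => exact symm_maps x hx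

theorem orbit_step {x v u : Fin 7 → ℤ}
    (hv : v ∈ MulAction.orbit (Subgroup.closure {w1, w2} :
        Subgroup ((Fin 7 → ℤ) ≃ₗ[ℤ] (Fin 7 → ℤ))) x) (h : w2 v = u) :
    u ∈ MulAction.orbit (Subgroup.closure {w1, w2} :
        Subgroup ((Fin 7 → ℤ) ≃ₗ[ℤ] (Fin 7 → ℤ))) x := by
  have hw : w2 ∈ Subgroup.closure {w1, w2} :=
    Subgroup.subset_closure (Set.mem_insert_of_mem _ rfl)
  have key := MulAction.mem_orbit_of_mem_orbit
    (⟨w2, hw⟩ : Subgroup.closure {w1, w2}) hv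
  rw [← h]
  exact key

/-- The orbit of e_σ = (0,0,0,0,0,0,1) under ⟨w₁, w₂⟩ consists of exactly the seven listed
vectors (coordinates ordered α, β, γ, δ, ε, η, σ). -/
theorem stmt9 :
    MulAction.orbit (Subgroup.closure {w1, w2} :
        Subgroup ((Fin 7 → ℤ) ≃ₗ[ℤ] (Fin 7 → ℤ))) (![0, 0, 0, 0, 0, 0, 1] : Fin 7 → ℤ) =
      {![0, 0, 0, 0, 0, 0, 1], ![0, 0, 0, 1, 0, 0, 1], ![0, 1, 1, 1, 1, 0, 1],
       ![0, 0, 1, 2, 1, 1, 1], ![1, 2, 2, 2, 2, 1, 1], ![1, 1, 2, 3, 2, 1, 1],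
       ![1, 2, 3, 3, 2, 1, 1]} := by
  apply Set.Subset.antisymm
  · rintro _ ⟨g, rfl⟩
    exact closure_maps g.1 g.2 _ (Or.inl rfl)
  · have h1 := MulAction.mem_orbit_self (M := (Subgroup.closure {w1, w2} :
        Subgroup ((Fin 7 → ℤ) ≃ₗ[ℤ] (Fin 7 → ℤ)))) (![0, 0, 0, 0, 0, 0, 1] : Fin 7 → ℤ)
    have h2 := orbit_step h1 (u := ![0, 1, 1, 1, 1, 0, 1]) (by
      rw [w2_vec, refl_vec1, refl_vec3, refl_vec5, w1_vec]; norm_num)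
    have h3 := orbit_step h2 (u := ![1, 2, 2, 2, 2, 1, 1]) (by
      rw [w2_vec, refl_vec1, refl_vec3, refl_vec5, w1_vec]; norm_num)
    have h4 := orbit_step h3 (u := ![1, 2, 3, 3, 2, 1, 1]) (by
      rw [w2_vec, refl_vec1, refl_vec3, refl_vec5, w1_vec]; norm_num)
    have h5 := orbit_step h4 (u := ![1, 1, 2, 3, 2, 1, 1]) (by
      rw [w2_vec, refl_vec1, refl_vec3, refl_vec5, w1_vec]; norm_num)
    have h6 := orbit_step h5 (u := ![0, 0, 1, 2, 1, 1, 1]) (by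
      rw [w2_vec, refl_vec1, refl_vec3, refl_vec5, w1_vec]; norm_num)
    have h7 := orbit_step h6 (u := ![0, 0, 0, 1, 0, 0, 1]) (by
      rw [w2_vec, refl_vec1, refl_vec3, refl_vec5, w1_vec]; norm_num)
    intro v hv
    simp only [Set.mem_insert_iff, Set.mem_singleton_iff] at hv
    rcases hv with rfl | rfl | rfl | rfl | rfl | rfl | rfl <;> assumption
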